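/- arXiv:1511.07167 — 4 statements merged into one kernel-verified Lean document; each statement's English description precedes it below -/
import Mathlib

section
/- For every d ≥ 3 there exists a Borel measurable function V : ℝ^d → ℝ with V ≤ 0 such that sup_{t > 0, x,y ∈ ℝ^d} S(V,t,x,y) < ∞, yet V ∉ L¹(ℝ^d) and, for every p > 1, V ∉ L^p_{loc}(ℝ^d). -/
open MeasureTheory Real Filter
open scoped ENNReal Topology

/-- The Gauss–Weierstrass kernel `g_d(t,x,y) = (4πt)^{-d/2} exp(-|y-x|²/(4t))` on `ℝ^d`. -/
noncomputable def gwk (d : ℕ) (t : ℝ) (x y : EuclideanSpace ℝ (Fin d)) : ℝ :=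
  (4 * Real.pi * t) ^ (-(d : ℝ) / 2) * Real.exp (-‖y - x‖ ^ 2 / (4 * t))

/-- `S(V,t,x,y) = ∫₀^t ∫_{ℝ^d} (g_d(s,x,z) g_d(t-s,z,y)/g_d(t,x,y)) |V(z)| dz ds ∈ [0,∞]`. -/
noncomputable def Sq (d : ℕ) (V : EuclideanSpace ℝ (Fin d) → ℝ) (t : ℝ)
    (x y : EuclideanSpace ℝ (Fin d)) : ℝ≥0∞ :=
  ∫⁻ s in Set.Ioo (0 : ℝ) t, ∫⁻ z,
    ENNReal.ofReal (gwk d s x z * gwk d (t - s) z y / gwk d t x y * |V z|)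

/-- The bridge operator `T^{t,y}_s f (x)`. -/
noncomputable def bridgeOp (d : ℕ) (t s : ℝ) (y : EuclideanSpace ℝ (Fin d))
    (f : EuclideanSpace ℝ (Fin d) → ℝ) (x : EuclideanSpace ℝ (Fin d)) : ℝ :=
  ∫ z, gwk d s x z * gwk d (t - s) z y / gwk d t x y * f z

/-- The constant `C(d,p)`. -/
noncomputable def Cconst (d : ℕ) (p : ℝ) : ℝ :=
  if p = 1 then (4 * Real.pi) ^ (-(d : ℝ) / 2)
  else (4 * Real.pi) ^ (-(d : ℝ) / (2 * p)) * (1 - p⁻¹) ^ ((1 - p⁻¹) * (d : ℝ) / 2)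

/-- The integral of a product of functions of the separate coordinates is the product of the
integrals. -/
lemma lintegral_pi_prod (n : ℕ) (F : Fin n → ℝ → ℝ≥0∞) (hF : ∀ i, Measurable (F i)) :
    ∫⁻ z : Fin n → ℝ, ∏ i, F i (z i) = ∏ i, ∫⁻ r, F i r := by
  induction n with
  | zero => simp [volume_pi]
  | succ n ih =>
    have hm := (volume_preserving_piFinSuccAbove (fun _ : Fin (n + 1) => ℝ) 0).symm
    rw [← hm.lintegral_comp_emb (MeasurableEquiv.measurableEmbedding _)]
    simp_rw [MeasurableEquiv.piFinSuccAbove_symm_apply, Fin.insertNthEquiv,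
      Fin.prod_univ_succ, Fin.insertNth_zero]
    simp only [Equiv.coe_fn_mk, Fin.cons_zero, Fin.cons_succ]
    rw [← ih (fun i => F i.succ) (fun i => hF _), Measure.volume_eq_prod]
    exact lintegral_prod_mul (hF 0).aemeasurable
      (Finset.measurable_fun_prod _
        fun (i : Fin n) _ => (hF i.succ).comp (measurable_pi_apply i)).aemeasurable

lemma lintegral_euclidean_prod (n : ℕ) (F : Fin n → ℝ → ℝ≥0∞) (hF : ∀ i, Measurable (F i)) :
    ∫⁻ z : EuclideanSpace ℝ (Fin n), ∏ i, F i (z i) = ∏ i, ∫⁻ r, F i r := by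
  rw [← lintegral_pi_prod n F hF]
  exact (PiLp.volume_preserving_ofLp (Fin n)).lintegral_comp
    (f := fun z : Fin n → ℝ => ∏ i, F i (z i))
    (Finset.measurable_fun_prod _ fun i _ => (hF i).comp (measurable_pi_apply i))

/-- The Gauss–Weierstrass kernel on the line. -/
noncomputable def gwkLine (t a b : ℝ) : ℝ := (√(4 * π * t))⁻¹ * Real.exp (-(b - a) ^ 2 / (4 * t))

lemma gwk_eq_prod (d : ℕ) {t : ℝ} (ht : 0 < t) (x y : EuclideanSpace ℝ (Fin d)) :
    gwk d t x y = ∏ i, gwkLine t (x i) (y i) := by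
  unfold gwk gwkLine
  rw [Finset.prod_mul_distrib, ← Real.exp_sum, EuclideanSpace.norm_sq_eq]
  congr 1
  · rw [Finset.prod_const, Finset.card_univ, Fintype.card_fin, Real.sqrt_eq_rpow,
      ← Real.rpow_neg (by positivity), ← Real.rpow_natCast, ← Real.rpow_mul (by positivity)]
    congr 1
    ring
  · rw [← Finset.sum_div, Finset.sum_neg_distrib]
    simp

/-- The transition density of the one-dimensional Brownian bridge is Gaussian. -/
lemma bridge_eq_gaussianPDFReal {s r : ℝ} (hs : 0 < s) (hr : 0 < r) (a b z : ℝ) :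
    gwkLine s a z * gwkLine r z b / gwkLine (s + r) a b =
      ProbabilityTheory.gaussianPDFReal ((r * a + s * b) / (s + r))
        (Real.toNNReal (2 * (s * r / (s + r)))) z := by
  unfold gwkLine ProbabilityTheory.gaussianPDFReal
  rw [Real.coe_toNNReal _ (by positivity), mul_mul_mul_comm, mul_div_mul_comm, ← Real.exp_add,
    ← Real.exp_sub]
  congr 1
  · rw [show 2 * π * (2 * (s * r / (s + r))) = (4 * π * s) * (4 * π * r) / (4 * π * (s + r)) by
      field_simp; ring, Real.sqrt_div (by positivity),
      Real.sqrt_mul (show 0 ≤ 4 * π * s by positivity), inv_div, inv_eq_one_div, inv_eq_one_div,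
      inv_eq_one_div, div_mul_div_comm, div_div_div_eq, one_mul, one_mul, mul_one]
  · congr 1
    field_simp
    ring

lemma bridge_le {s r : ℝ} (hs : 0 < s) (hr : 0 < r) (a b z : ℝ) :
    gwkLine s a z * gwkLine r z b / gwkLine (s + r) a b ≤ (√(4 * π * (s * r / (s + r))))⁻¹ := by
  rw [bridge_eq_gaussianPDFReal hs hr]
  unfold ProbabilityTheory.gaussianPDFReal
  rw [Real.coe_toNNReal _ (by positivity),
    show 2 * π * (2 * (s * r / (s + r))) = 4 * π * (s * r / (s + r)) by ring]
  refine mul_le_of_le_one_right (by positivity) (Real.exp_le_one_iff.2 ?_)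
  exact div_nonpos_of_nonpos_of_nonneg (by nlinarith [sq_nonneg (z - (r * a + s * b) / (s + r))])
    (by positivity)

lemma bridge_nonneg (s r t a b z : ℝ) :
    0 ≤ gwkLine s a z * gwkLine r z b / gwkLine t a b := by
  unfold gwkLine
  positivity

lemma measurable_bridge (s r t a b : ℝ) :
    Measurable fun z => gwkLine s a z * gwkLine r z b / gwkLine t a b := by
  unfold gwkLine
  fun_prop

lemma lintegral_bridge {s r : ℝ} (hs : 0 < s) (hr : 0 < r) (a b : ℝ) :
    ∫⁻ z, ENNReal.ofReal (gwkLine s a z * gwkLine r z b / gwkLine (s + r) a b) = 1 := by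
  simp_rw [bridge_eq_gaussianPDFReal hs hr]
  refine ProbabilityTheory.lintegral_gaussianPDFReal_eq_one _ ?_
  rw [Ne, Real.toNNReal_eq_zero, not_le]
  positivity

/-- The integrable function `1 / (x log² x)` on `(0, 1/2]`, which is in no `L^p` with `p > 1`. -/
noncomputable def invLogSq : ℝ → ℝ :=
  (Set.Ioc 0 (1 / 2)).indicator fun x => x⁻¹ / Real.log x ^ 2

lemma invLogSq_nonneg (x : ℝ) : 0 ≤ invLogSq x :=
  Set.indicator_nonneg (fun y hy => by have := hy.1; positivity) x

lemma measurable_invLogSq : Measurable invLogSq :=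
  Measurable.indicator (by fun_prop) measurableSet_Ioc

lemma continuousOn_inv_log : ContinuousOn (fun x => -(Real.log x)⁻¹) (Set.Icc 0 (1 / 2)) := by
  intro x hx
  rcases hx.1.eq_or_lt with rfl | h
  · have h0 : Tendsto (fun x => -(Real.log x)⁻¹) (𝓝[≠] 0) (𝓝 0) := by
      simpa using (Real.tendsto_log_nhdsNE_zero.inv_tendsto_atBot).neg
    refine ContinuousAt.continuousWithinAt ?_
    rw [continuousAt_iff_punctured_nhds]
    simpa using h0
  · have : Real.log x ≠ 0 := (Real.log_neg h (by linarith [hx.2])).ne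
    exact (((Real.continuousAt_log h.ne').inv₀ this).neg).continuousWithinAt

lemma lintegral_invLogSq_lt_top : ∫⁻ x, ENNReal.ofReal (invLogSq x) < ⊤ := by
  have hint : IntegrableOn (fun x => x⁻¹ / Real.log x ^ 2) (Set.Ioc 0 (1 / 2)) := by
    refine intervalIntegral.integrableOn_deriv_of_nonneg continuousOn_inv_log ?_ ?_
    · intro x hx
      have h : Real.log x ≠ 0 := (Real.log_neg hx.1 (by linarith [hx.2])).ne
      exact ((Real.hasDerivAt_log hx.1.ne').inv h).neg.congr_deriv (by ring)
    · intro x hx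
      have := hx.1
      positivity
  exact ((integrable_indicator_iff measurableSet_Ioc).2 hint).lintegral_lt_top

lemma lintegral_invLogSq_rpow {p : ℝ} (hp : 1 < p) :
    ∫⁻ x, (Set.Icc 0 1).indicator (fun x => ENNReal.ofReal (invLogSq x ^ p)) x = ⊤ := by
  have hp0 : 0 < p := by linarith
  set δ : ℝ := (1 - p⁻¹) / 2 with hδ
  have hδ0 : 0 < δ := by
    have : p⁻¹ < 1 := inv_lt_one_of_one_lt₀ hp
    rw [hδ]; linarith
  have key : ∀ x ∈ Set.Ioc (0 : ℝ) (1 / 2), (δ ^ 2) ^ p * x⁻¹ ≤ invLogSq x ^ p := by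
    intro x hx
    have hx0 := hx.1
    have hl : Real.log x < 0 := Real.log_neg hx.1 (by linarith [hx.2])
    have hl0 : Real.log x ≠ 0 := hl.ne
    have hlog := Real.abs_log_mul_self_rpow_lt x δ hx.1 (by linarith [hx.2]) hδ0
    have h2 : Real.log x ^ 2 * (x ^ δ) ^ 2 ≤ (1 / δ) ^ 2 := by
      rw [← mul_pow, ← sq_abs]
      exact pow_le_pow_left₀ (abs_nonneg _) hlog.le 2
    have h3 : x⁻¹ = (x ^ (-p⁻¹)) ^ p := by
      rw [← Real.rpow_mul hx0.le, neg_mul, inv_mul_cancel₀ hp0.ne', Real.rpow_neg_one]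
    have h4 : x ^ (-p⁻¹) = x⁻¹ * (x ^ δ) ^ 2 := by
      rw [← Real.rpow_natCast, ← Real.rpow_mul hx0.le, ← Real.rpow_neg_one x, ← Real.rpow_add hx0]
      congr 1
      rw [hδ]; push_cast; ring
    rw [h3, ← Real.mul_rpow (by positivity) (by positivity), invLogSq, Set.indicator_of_mem hx]
    refine Real.rpow_le_rpow (by positivity) ?_ hp0.le
    rw [h4, le_div_iff₀ (by positivity)]
    calc δ ^ 2 * (x⁻¹ * (x ^ δ) ^ 2) * Real.log x ^ 2
        = δ ^ 2 * x⁻¹ * (Real.log x ^ 2 * (x ^ δ) ^ 2) := by ring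
      _ ≤ δ ^ 2 * x⁻¹ * (1 / δ) ^ 2 := by gcongr
      _ = x⁻¹ := by field_simp
  have hinv : ∫⁻ x in Set.Ioc (0 : ℝ) (1 / 2), ENNReal.ofReal x⁻¹ = ⊤ := by
    by_contra hne
    have hi : IntegrableOn (fun x : ℝ => x⁻¹) (Set.Ioc 0 (1 / 2)) := by
      refine (lintegral_ofReal_ne_top_iff_integrable (by fun_prop) ?_).1 hne
      filter_upwards [ae_restrict_mem measurableSet_Ioc] with x hx
      exact inv_nonneg.2 hx.1.le
    rw [← intervalIntegrable_iff_integrableOn_Ioc_of_le (by norm_num),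
      intervalIntegrable_inv_iff] at hi
    norm_num at hi
  refine top_le_iff.1 ?_
  calc ⊤ = ENNReal.ofReal ((δ ^ 2) ^ p) * ∫⁻ x in Set.Ioc (0 : ℝ) (1 / 2), ENNReal.ofReal x⁻¹ := by
        rw [hinv, ENNReal.mul_top]
        exact (ENNReal.ofReal_pos.2 (by positivity)).ne'
    _ = ∫⁻ x in Set.Ioc (0 : ℝ) (1 / 2), ENNReal.ofReal ((δ ^ 2) ^ p * x⁻¹) := by
        rw [← lintegral_const_mul _ (by fun_prop)]
        simp_rw [ENNReal.ofReal_mul (show 0 ≤ (δ ^ 2) ^ p by positivity)]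
    _ ≤ ∫⁻ x in Set.Ioc (0 : ℝ) (1 / 2), ENNReal.ofReal (invLogSq x ^ p) :=
        setLIntegral_mono' measurableSet_Ioc fun x hx => ENNReal.ofReal_le_ofReal (key x hx)
    _ ≤ _ := by
        rw [lintegral_indicator measurableSet_Icc]
        exact lintegral_mono_set fun x hx => ⟨hx.1.le, by linarith [hx.2]⟩

/-- The one-dimensional factors of the potential. -/
noncomputable def profile : ℕ → ℝ → ℝ
  | 0 => invLogSq
  | 1 => (Set.Icc 0 1).indicator 1
  | 2 => fun x => (1 + |x|)⁻¹
  | _ => 1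

lemma profile_nonneg (i : ℕ) (x : ℝ) : 0 ≤ profile i x := by
  match i with
  | 0 => exact invLogSq_nonneg x
  | 1 => exact Set.indicator_nonneg (fun _ _ => zero_le_one) x
  | 2 => simp only [profile]; positivity
  | _ + 3 => simp [profile]

lemma measurable_profile (i : ℕ) : Measurable (profile i) := by
  match i with
  | 0 => exact measurable_invLogSq
  | 1 => exact measurable_one.indicator measurableSet_Icc
  | 2 => simp only [profile]; fun_prop
  | _ + 3 => exact measurable_one

lemma profile_le_one {i : ℕ} (hi : i ≠ 0) (x : ℝ) : profile i x ≤ 1 := by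
  match i, hi with
  | 1, _ => exact Set.indicator_le_self' (fun _ _ => zero_le_one) x
  | 2, _ => exact inv_le_one_of_one_le₀ (by linarith [abs_nonneg x])
  | _ + 3, _ => simp [profile]

lemma profile_pos {i : ℕ} (hi : i ≠ 0) {x : ℝ} (hx : x ∈ Set.Icc (0 : ℝ) 1) :
    0 < profile i x := by
  match i, hi with
  | 1, _ => simp only [profile, Set.indicator_of_mem hx]; simp
  | 2, _ => simp only [profile]; positivity
  | _ + 3, _ => simp [profile]

lemma lintegral_indicator_Icc_ne_zero {f : ℝ → ℝ} (hf : Measurable f)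
    (hpos : ∀ x ∈ Set.Icc (0 : ℝ) 1, 0 < f x) :
    ∫⁻ x, (Set.Icc 0 1).indicator (fun x => ENNReal.ofReal (f x)) x ≠ 0 := by
  rw [lintegral_indicator measurableSet_Icc, ← pos_iff_ne_zero,
    setLIntegral_pos_iff hf.ennreal_ofReal]
  refine lt_of_lt_of_le ?_ (measure_mono (s := Set.Icc (0 : ℝ) 1) fun x hx => ⟨?_, hx⟩)
  · simp
  · exact (ENNReal.ofReal_pos.2 (hpos x hx)).ne'

lemma lintegral_profile_zero_ne_zero : ∫⁻ x, ENNReal.ofReal (profile 0 x) ≠ 0 := by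
  intro h
  rw [lintegral_eq_zero_iff (measurable_profile 0).ennreal_ofReal] at h
  have h2 := lintegral_invLogSq_rpow one_lt_two
  rw [lintegral_congr_ae (g := 0), Pi.zero_def, lintegral_zero] at h2
  · simp at h2
  · filter_upwards [h] with x hx
    simp only [profile, Pi.zero_apply, ENNReal.ofReal_eq_zero] at hx
    have : invLogSq x = 0 := le_antisymm hx (invLogSq_nonneg x)
    simp [this]

lemma lintegral_profile_ne_zero (i : ℕ) : ∫⁻ x, ENNReal.ofReal (profile i x) ≠ 0 := by
  rcases eq_or_ne i 0 with rfl | hi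
  · exact lintegral_profile_zero_ne_zero
  · intro h
    refine lintegral_indicator_Icc_ne_zero (measurable_profile i) (fun x => profile_pos hi) ?_
    rw [← nonpos_iff_eq_zero, ← h]
    exact lintegral_mono fun x => Set.indicator_le_self _ _ x

lemma lintegral_profile_two : ∫⁻ x, ENNReal.ofReal (profile 2 x) = ⊤ := by
  by_contra hne
  have hi : Integrable (profile 2) :=
    (lintegral_ofReal_ne_top_iff_integrable (measurable_profile 2).aestronglyMeasurable
      (ae_of_all _ (profile_nonneg 2))).1 hne
  refine not_integrableOn_Ioi_inv (a := 1) ?_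
  refine Integrable.mono' (hi.integrableOn.const_mul 2) (by fun_prop) ?_
  filter_upwards [ae_restrict_mem measurableSet_Ioi] with x hx
  have hx : (1 : ℝ) < x := hx
  have hx0 : 0 < x := by linarith
  simp only [profile, norm_inv, Real.norm_eq_abs, abs_of_pos hx0]
  rw [← div_eq_mul_inv, inv_eq_one_div, div_le_div_iff₀ hx0 (by linarith)]
  linarith

lemma prod_eq_top {ι : Type*} [Fintype ι] [DecidableEq ι] (a : ι → ℝ≥0∞) (i : ι) (hi : a i = ⊤)
    (h : ∀ j ≠ i, a j ≠ 0) : ∏ j, a j = ⊤ := by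
  rw [← Finset.mul_prod_erase _ _ (Finset.mem_univ i), hi, ENNReal.top_mul]
  exact Finset.prod_ne_zero_iff.2 fun j hj => h j (Finset.ne_of_mem_erase hj)

/-- The bridge average of the `i`-th factor of the potential. -/
noncomputable def bridgeAvg (i : ℕ) (s r a b : ℝ) : ℝ≥0∞ :=
  ∫⁻ z, ENNReal.ofReal (gwkLine s a z * gwkLine r z b / gwkLine (s + r) a b * profile i z)

lemma bridgeAvg_le_one {i : ℕ} (hi : i ≠ 0) {s r : ℝ} (hs : 0 < s) (hr : 0 < r) (a b : ℝ) :
    bridgeAvg i s r a b ≤ 1 := by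
  rw [← lintegral_bridge hs hr a b]
  exact lintegral_mono fun z => ENNReal.ofReal_le_ofReal
    (mul_le_of_le_one_right (bridge_nonneg _ _ _ _ _ _) (profile_le_one hi z))

lemma bridgeAvg_le (i : ℕ) {s r : ℝ} (hs : 0 < s) (hr : 0 < r) (a b : ℝ) :
    bridgeAvg i s r a b ≤ ENNReal.ofReal (√(4 * π * (s * r / (s + r))))⁻¹ *
      ∫⁻ x, ENNReal.ofReal (profile i x) := by
  rw [← lintegral_const_mul _ (measurable_profile i).ennreal_ofReal]
  refine lintegral_mono fun z => ?_
  rw [← ENNReal.ofReal_mul (by positivity)]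
  exact ENNReal.ofReal_le_ofReal
    (mul_le_mul_of_nonneg_right (bridge_le hs hr a b z) (profile_nonneg i z))

lemma lintegral_profile_one : ∫⁻ x, ENNReal.ofReal (profile 1 x) = 1 := by
  have : (fun x => ENNReal.ofReal (profile 1 x)) = (Set.Icc (0 : ℝ) 1).indicator 1 := by
    ext x
    by_cases hx : x ∈ Set.Icc (0 : ℝ) 1 <;> simp [profile, hx]
  rw [this, lintegral_indicator_one measurableSet_Icc]
  simp

lemma bridgeAvg_two_le {s r : ℝ} (hs : 0 < s) (hr : 0 < r) (a b : ℝ) :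
    bridgeAvg 2 s r a b ≤ ENNReal.ofReal (3 * √(√(4 * π * (s * r / (s + r))))⁻¹) := by
  set c := (√(4 * π * (s * r / (s + r))))⁻¹ with hc
  have hc0 : 0 < c := by positivity
  set l := √c with hl
  have hl0 : 0 < l := by positivity
  have hcl : c = l * l := (Real.mul_self_sqrt hc0.le).symm
  have hpt : ∀ z, ENNReal.ofReal (gwkLine s a z * gwkLine r z b / gwkLine (s + r) a b *
      profile 2 z) ≤
      ENNReal.ofReal l * ENNReal.ofReal (gwkLine s a z * gwkLine r z b / gwkLine (s + r) a b) +
        (Set.Icc (-l⁻¹) l⁻¹).indicator (fun _ => ENNReal.ofReal c) z := by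
    intro z
    have h0 := bridge_nonneg s r (s + r) a b z
    have h1 := bridge_le hs hr a b z
    by_cases hz : z ∈ Set.Icc (-l⁻¹) l⁻¹
    · rw [Set.indicator_of_mem hz]
      refine le_add_left (ENNReal.ofReal_le_ofReal ?_)
      exact (mul_le_of_le_one_right h0 (profile_le_one two_ne_zero z)).trans h1
    · rw [Set.indicator_of_notMem hz, add_zero, ← ENNReal.ofReal_mul hl0.le, mul_comm]
      refine ENNReal.ofReal_le_ofReal (mul_le_mul_of_nonneg_right ?_ h0)
      rw [Set.mem_Icc, ← abs_le, not_le] at hz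
      exact inv_le_of_inv_le₀ hl0 (by linarith)
  refine (lintegral_mono hpt).trans ?_
  rw [lintegral_add_right _ (measurable_const.indicator measurableSet_Icc),
    lintegral_const_mul _ (measurable_bridge _ _ _ _ _).ennreal_ofReal, lintegral_bridge hs hr,
    lintegral_indicator_const measurableSet_Icc, Real.volume_Icc, ← ENNReal.ofReal_mul hc0.le,
    mul_one, ← ENNReal.ofReal_add hl0.le (by rw [sub_neg_eq_add]; positivity)]
  refine ENNReal.ofReal_le_ofReal (le_of_eq ?_)
  rw [hcl]
  field_simp
  ring

/-- An integrable majorant for the spatial integrals. -/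
noncomputable def majorant (w : ℝ) : ℝ≥0∞ :=
  ENNReal.ofReal (min (w ^ (-(1 / 2) : ℝ)) (3 * w ^ (-(5 / 4) : ℝ)))

lemma measurable_majorant : Measurable majorant := by
  unfold majorant
  fun_prop

lemma lintegral_majorant_lt_top : ∫⁻ w in Set.Ioi 0, majorant w < ⊤ := by
  rw [← Set.Ioc_union_Ioi_eq_Ioi zero_le_one]
  refine (lintegral_union_le _ _ _).trans_lt (ENNReal.add_lt_top.2 ⟨?_, ?_⟩)
  · have h : IntegrableOn (fun w : ℝ => w ^ (-(1 / 2) : ℝ)) (Set.Ioc 0 1) := by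
      rw [← intervalIntegrable_iff_integrableOn_Ioc_of_le zero_le_one]
      exact intervalIntegral.intervalIntegrable_rpow' (by norm_num)
    exact (lintegral_mono fun w => ENNReal.ofReal_le_ofReal (min_le_left _ _)).trans_lt
      h.lintegral_lt_top
  · have h : IntegrableOn (fun w : ℝ => 3 * w ^ (-(5 / 4) : ℝ)) (Set.Ioi 1) :=
      (integrableOn_Ioi_rpow_of_lt (by norm_num) zero_lt_one).const_mul 3
    exact (lintegral_mono fun w => ENNReal.ofReal_le_ofReal (min_le_right _ _)).trans_lt
      h.lintegral_lt_top

lemma le_majorant {w u : ℝ} (hw : 0 < w) (hu : w / 2 ≤ u) :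
    ENNReal.ofReal (√(4 * π * u))⁻¹ *
      min 1 (ENNReal.ofReal (√(4 * π * u))⁻¹ * ENNReal.ofReal (3 * √(√(4 * π * u))⁻¹)) ≤
      majorant w := by
  have hc : (√(4 * π * u))⁻¹ ≤ w ^ (-(1 / 2) : ℝ) := by
    rw [Real.rpow_neg hw.le, ← Real.sqrt_eq_rpow]
    refine inv_anti₀ (by positivity) (Real.sqrt_le_sqrt ?_)
    nlinarith [Real.pi_gt_three]
  set c := (√(4 * π * u))⁻¹
  have hc0 : 0 ≤ c := by positivity
  have hsc : √c ≤ w ^ (-(1 / 4) : ℝ) := by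
    rw [Real.sqrt_eq_rpow]
    refine (Real.rpow_le_rpow hc0 hc (by norm_num)).trans_eq ?_
    rw [← Real.rpow_mul hw.le]
    norm_num
  unfold majorant
  rw [ENNReal.ofReal_min]
  refine le_min ?_ ?_
  · exact (mul_le_of_le_one_right (zero_le) (min_le_left _ _)).trans
      (ENNReal.ofReal_le_ofReal hc)
  · refine (mul_le_mul_right (min_le_right _ _) _).trans ?_
    rw [← ENNReal.ofReal_mul hc0, ← ENNReal.ofReal_mul hc0]
    refine ENNReal.ofReal_le_ofReal ?_
    calc c * (c * (3 * √c))
        ≤ w ^ (-(1 / 2) : ℝ) * (w ^ (-(1 / 2) : ℝ) * (3 * w ^ (-(1 / 4) : ℝ))) := by gcongr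
      _ = 3 * (w ^ (-(1 / 2) : ℝ) * w ^ (-(1 / 2) : ℝ) * w ^ (-(1 / 4) : ℝ)) := by ring
      _ = 3 * w ^ (-(5 / 4) : ℝ) := by
        rw [← Real.rpow_add hw, ← Real.rpow_add hw]
        norm_num

/-- The potential: a product of functions of the separate coordinates. -/
noncomputable def potential (d : ℕ) (z : EuclideanSpace ℝ (Fin d)) : ℝ :=
  -∏ i : Fin d, profile i (z i)

lemma abs_potential (d : ℕ) (z : EuclideanSpace ℝ (Fin d)) :
    |potential d z| = ∏ i : Fin d, profile i (z i) := by
  rw [potential, abs_neg, abs_of_nonneg (Finset.prod_nonneg fun i _ => profile_nonneg _ _)]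

lemma measurable_potential (d : ℕ) : Measurable (potential d) :=
  (Finset.measurable_fun_prod _ fun (i : Fin d) _ => (measurable_profile i).comp
    (by fun_prop : Measurable fun z : EuclideanSpace ℝ (Fin d) => z i)).neg

lemma lintegral_bridge_potential (d : ℕ) {s r : ℝ} (hs : 0 < s) (hr : 0 < r)
    (x y : EuclideanSpace ℝ (Fin d)) :
    ∫⁻ z, ENNReal.ofReal (gwk d s x z * gwk d r z y / gwk d (s + r) x y * |potential d z|) =
      ∏ i : Fin d, bridgeAvg i s r (x i) (y i) := by
  unfold bridgeAvg
  rw [← lintegral_euclidean_prod d (fun i z => ENNReal.ofReal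
    (gwkLine s (x i) z * gwkLine r z (y i) / gwkLine (s + r) (x i) (y i) * profile i z))
    fun i => ((measurable_bridge _ _ _ _ _).mul (measurable_profile i)).ennreal_ofReal]
  refine lintegral_congr fun z => ?_
  rw [gwk_eq_prod d hs, gwk_eq_prod d hr, gwk_eq_prod d (add_pos hs hr), abs_potential,
    ← Finset.prod_mul_distrib, ← Finset.prod_div_distrib, ← Finset.prod_mul_distrib,
    ENNReal.ofReal_prod_of_nonneg]
  exact fun i _ => mul_nonneg (bridge_nonneg _ _ _ _ _ _) (profile_nonneg _ _)

lemma prod_bridgeAvg_le (n : ℕ) {s r : ℝ} (hs : 0 < s) (hr : 0 < r) (x y : Fin (n + 3) → ℝ) :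
    ∏ i : Fin (n + 3), bridgeAvg i s r (x i) (y i) ≤
      (∫⁻ x, ENNReal.ofReal (invLogSq x)) * (majorant s + majorant r) := by
  have hmaj : ∃ w, 0 < w ∧ w / 2 ≤ s * r / (s + r) ∧ majorant w ≤ majorant s + majorant r := by
    rcases le_total s r with h | h
    · refine ⟨s, hs, ?_, le_self_add⟩
      rw [div_le_div_iff₀ two_pos (by positivity)]
      nlinarith
    · refine ⟨r, hr, ?_, le_add_self⟩
      rw [div_le_div_iff₀ two_pos (by positivity)]
      nlinarith
  obtain ⟨w, hw, hwu, hle⟩ := hmaj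
  have h0 := bridgeAvg_le 0 hs hr (x 0) (y 0)
  have h1 := bridgeAvg_le 1 hs hr (x 1) (y 1)
  have h2 := bridgeAvg_two_le hs hr (x 2) (y 2)
  have h3 := le_majorant hw hwu
  rw [lintegral_profile_one, mul_one] at h1
  have h12 : bridgeAvg 1 s r (x 1) (y 1) * bridgeAvg 2 s r (x 2) (y 2) ≤ 1 :=
    mul_le_one' (bridgeAvg_le_one one_ne_zero hs hr _ _) (bridgeAvg_le_one two_ne_zero hs hr _ _)
  have hrest : ∏ i : Fin n, bridgeAvg (i.succ.succ.succ : Fin (n + 3)) s r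
      (x i.succ.succ.succ) (y i.succ.succ.succ) ≤ 1 :=
    Finset.prod_le_one' fun i _ => bridgeAvg_le_one (by simp) hs hr _ _
  rw [Fin.prod_univ_succ, Fin.prod_univ_succ, Fin.prod_univ_succ]
  calc _ ≤ bridgeAvg 0 s r (x 0) (y 0) *
        (bridgeAvg 1 s r (x 1) (y 1) * (bridgeAvg 2 s r (x 2) (y 2) * 1)) := by
        exact mul_le_mul' le_rfl (mul_le_mul' le_rfl (mul_le_mul' le_rfl hrest))
    _ ≤ _ := by
        rw [mul_one]
        refine (mul_le_mul' h0 (le_min h12 (mul_le_mul' h1 h2))).trans ?_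
        rw [mul_comm (ENNReal.ofReal _), mul_assoc]
        exact mul_le_mul' le_rfl (h3.trans hle)

lemma Sq_potential_le (n : ℕ) {t : ℝ} (x y : EuclideanSpace ℝ (Fin (n + 3))) :
    Sq (n + 3) (potential (n + 3)) t x y ≤
      (∫⁻ x, ENNReal.ofReal (invLogSq x)) * (2 * ∫⁻ w in Set.Ioi 0, majorant w) := by
  have hm : Measurable fun s => majorant (t - s) := measurable_majorant.comp (by fun_prop)
  calc Sq (n + 3) (potential (n + 3)) t x y
      ≤ ∫⁻ s in Set.Ioo 0 t,
          (∫⁻ x, ENNReal.ofReal (invLogSq x)) * (majorant s + majorant (t - s)) := by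
        refine setLIntegral_mono' measurableSet_Ioo fun s hs => ?_
        have hr : 0 < t - s := sub_pos.2 hs.2
        have h := lintegral_bridge_potential (n + 3) hs.1 hr x y
        rw [add_sub_cancel] at h
        rw [h]
        exact prod_bridgeAvg_le n hs.1 hr _ _
    _ = (∫⁻ x, ENNReal.ofReal (invLogSq x)) *
          ((∫⁻ s in Set.Ioo 0 t, majorant s) + ∫⁻ s in Set.Ioo 0 t, majorant (t - s)) := by
        rw [lintegral_const_mul (f := fun s => majorant s + majorant (t - s)) _
            (measurable_majorant.add hm),
          lintegral_add_left measurable_majorant]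
    _ ≤ _ := by
        rw [two_mul]
        refine mul_le_mul' le_rfl (add_le_add ?_ ?_)
        · exact lintegral_mono_set Set.Ioo_subset_Ioi_self
        · rw [← lintegral_indicator measurableSet_Ioo, ← lintegral_indicator measurableSet_Ioi,
            ← lintegral_sub_left_eq_self _ t]
          refine lintegral_mono fun s => ?_
          by_cases hs : t - s ∈ Set.Ioo 0 t
          · have h2 : s ∈ Set.Ioi (0 : ℝ) := by simpa using hs.2
            simp [Set.indicator_of_mem hs, Set.indicator_of_mem h2]
          · simp [Set.indicator_of_notMem hs]

lemma not_integrable_potential (n : ℕ) : ¬ Integrable (potential (n + 3)) volume := by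
  intro h
  have h1 := h.norm.lintegral_lt_top
  refine h1.ne ?_
  simp_rw [Real.norm_eq_abs, abs_potential,
    ENNReal.ofReal_prod_of_nonneg fun (i : Fin (n + 3)) _ => profile_nonneg _ _]
  rw [lintegral_euclidean_prod (n + 3) (fun i z => ENNReal.ofReal (profile i z))
    fun i => (measurable_profile i).ennreal_ofReal]
  exact prod_eq_top _ 2 lintegral_profile_two fun j _ => lintegral_profile_ne_zero j

lemma lintegral_potential_rpow (n : ℕ) {p : ℝ} (hp : 1 < p) :
    ∃ K : Set (EuclideanSpace ℝ (Fin (n + 3))), IsCompact K ∧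
      ∫⁻ x in K, ENNReal.ofReal (|potential (n + 3) x| ^ p) = ⊤ := by
  have hK : IsCompact ((PiLp.continuousLinearEquiv 2 ℝ fun _ : Fin (n + 3) => ℝ) ⁻¹'
      Set.univ.pi fun _ => Set.Icc (0 : ℝ) 1) :=
    (PiLp.continuousLinearEquiv 2 ℝ fun _ : Fin (n + 3) => ℝ).toHomeomorph.isCompact_preimage.2
      (isCompact_univ_pi fun _ => isCompact_Icc)
  refine ⟨_, hK, ?_⟩
  rw [← lintegral_indicator hK.measurableSet]
  have hm : ∀ i : Fin (n + 3), Measurable fun z => ENNReal.ofReal (profile i z ^ p) :=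
    fun i => ((measurable_profile i).pow_const p).ennreal_ofReal
  have hpt : ∀ z : EuclideanSpace ℝ (Fin (n + 3)),
      ((PiLp.continuousLinearEquiv 2 ℝ fun _ : Fin (n + 3) => ℝ) ⁻¹'
        Set.univ.pi fun _ => Set.Icc (0 : ℝ) 1).indicator
        (fun x => ENNReal.ofReal (|potential (n + 3) x| ^ p)) z =
      ∏ i : Fin (n + 3), (Set.Icc 0 1).indicator
        (fun r => ENNReal.ofReal (profile i r ^ p)) (z i) := by
    intro z
    have hmem : z ∈ (PiLp.continuousLinearEquiv 2 ℝ fun _ : Fin (n + 3) => ℝ) ⁻¹'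
        (Set.univ.pi fun _ => Set.Icc (0 : ℝ) 1) ↔ ∀ i, z i ∈ Set.Icc (0 : ℝ) 1 :=
      Set.mem_univ_pi
    by_cases hz : ∀ i, z i ∈ Set.Icc (0 : ℝ) 1
    · rw [Set.indicator_of_mem (hmem.2 hz), abs_potential,
        ← Real.finsetProd_rpow _ _ fun i _ => profile_nonneg _ _,
        ENNReal.ofReal_prod_of_nonneg fun i _ => Real.rpow_nonneg (profile_nonneg _ _) _]
      exact Finset.prod_congr rfl fun i _ => by rw [Set.indicator_of_mem (hz i)]
    · rw [Set.indicator_of_notMem (mt hmem.1 hz)]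
      push Not at hz
      obtain ⟨i, hi⟩ := hz
      exact (Finset.prod_eq_zero (Finset.mem_univ i) (Set.indicator_of_notMem hi _)).symm
  rw [lintegral_congr hpt, lintegral_euclidean_prod (n + 3) (fun i => (Set.Icc 0 1).indicator
    (fun r => ENNReal.ofReal (profile i r ^ p))) fun i => (hm i).indicator measurableSet_Icc]
  refine prod_eq_top _ 0 (lintegral_invLogSq_rpow hp) fun j hj => ?_
  exact lintegral_indicator_Icc_ne_zero ((measurable_profile j).pow_const p) fun x hx =>
    Real.rpow_pos_of_pos (profile_pos (fun h => hj (Fin.ext h)) hx) p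

/-- for every `d ≥ 3` there is a Borel measurable `V ≤ 0` with
`sup_{t>0,x,y} S(V,t,x,y) < ∞`, `V ∉ L¹(ℝ^d)` and `V ∉ L^p_loc(ℝ^d)` for every `p > 1`. -/
theorem stmt12 (d : ℕ) (hd : 3 ≤ d) :
    ∃ V : EuclideanSpace ℝ (Fin d) → ℝ, Measurable V ∧ (∀ x, V x ≤ 0) ∧
      (∃ M : ℝ≥0∞, M < ⊤ ∧ ∀ t : ℝ, 0 < t → ∀ x y, Sq d V t x y ≤ M) ∧
      ¬ Integrable V volume ∧
      ∀ p : ℝ, 1 < p → ∃ K : Set (EuclideanSpace ℝ (Fin d)), IsCompact K ∧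
        ∫⁻ x in K, ENNReal.ofReal (|V x| ^ p) = ⊤ := by
  obtain ⟨n, rfl⟩ := Nat.exists_eq_add_of_le' hd
  refine ⟨potential (n + 3), measurable_potential _, fun x => ?_,
    ⟨_, ?_, fun t _ x y => Sq_potential_le n x y⟩, not_integrable_potential n,
    fun p hp => lintegral_potential_rpow n hp⟩
  · exact neg_nonpos.2 (Finset.prod_nonneg fun i _ => profile_nonneg _ _)
  · exact ENNReal.mul_lt_top lintegral_invLogSq_lt_top
      (ENNReal.mul_lt_top ENNReal.ofNat_lt_top lintegral_majorant_lt_top)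
end

section
/- Let d ≥ 1 and let V : ℝ^d → ℝ be Borel measurable. If S(V,t,x,y) < ∞ for some t > 0 and some x, y ∈ ℝ^d, then V is locally integrable on ℝ^d, i.e. ∫_K |V| dx < ∞ for every compact K ⊂ ℝ^d. -/
open MeasureTheory Real Filter
open scoped ENNReal Topology

theorem gwk_pos (d : ℕ) {t : ℝ} (ht : 0 < t) (x y : EuclideanSpace ℝ (Fin d)) :
    0 < gwk d t x y := by
  unfold gwk
  positivity

/-- Since `(0,t)` has positive measure, finiteness of `Sq` forces some spatial integral to be
finite. -/
theorem exists_lintegral_lt_top_of_Sq_lt_top {d : ℕ} {V : EuclideanSpace ℝ (Fin d) → ℝ} {t : ℝ}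
    (ht : 0 < t) {x y : EuclideanSpace ℝ (Fin d)} (hS : Sq d V t x y < ⊤) :
    ∃ s ∈ Set.Ioo (0 : ℝ) t,
      ∫⁻ z, ENNReal.ofReal (gwk d s x z * gwk d (t - s) z y / gwk d t x y * |V z|) < ⊤ := by
  by_contra! h
  have h_top : ∫⁻ _ in Set.Ioo (0 : ℝ) t, (⊤ : ℝ≥0∞) ≤ Sq d V t x y :=
    setLIntegral_mono' measurableSet_Ioo h
  rw [setLIntegral_const, Real.volume_Ioo, sub_zero,
    ENNReal.top_mul (ENNReal.ofReal_pos.2 ht).ne'] at h_top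
  exact hS.not_ge h_top

/-- if `S(V,t,x,y) < ∞` for some `t > 0`, `x,y ∈ ℝ^d`,
then `V` is locally integrable. -/
theorem stmt13 (d : ℕ) (hd : 1 ≤ d) (V : EuclideanSpace ℝ (Fin d) → ℝ) (hV : Measurable V)
    (t : ℝ) (ht : 0 < t) (x y : EuclideanSpace ℝ (Fin d)) (hS : Sq d V t x y < ⊤) :
    ∀ K : Set (EuclideanSpace ℝ (Fin d)), IsCompact K → IntegrableOn V K volume := by
  intro K hK
  obtain ⟨s, ⟨hs, hst⟩, h_fin⟩ := exists_lintegral_lt_top_of_Sq_lt_top ht hS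
  set k : EuclideanSpace ℝ (Fin d) → ℝ :=
    fun z ↦ gwk d s x z * gwk d (t - s) z y / gwk d t x y with hk
  have hk_pos (z) : 0 < k z :=
    div_pos (mul_pos (gwk_pos d hs x z) (gwk_pos d (sub_pos.2 hst) z y)) (gwk_pos d ht x y)
  have hk_cont : Continuous k := by
    simp only [hk, gwk]
    fun_prop
  have h_int : Integrable (fun z ↦ k z * |V z|) := by
    refine ⟨(hk_cont.measurable.mul hV.abs).aestronglyMeasurable, ?_⟩
    rwa [hasFiniteIntegral_iff_ofReal
      (Eventually.of_forall fun z ↦ mul_nonneg (hk_pos z).le (abs_nonneg _))]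
  have h_abs : IntegrableOn (fun z ↦ (k z)⁻¹ * (k z * |V z|)) K :=
    h_int.integrableOn.continuousOn_mul (hk_cont.inv₀ fun z ↦ (hk_pos z).ne').continuousOn hK
  refine (integrable_norm_iff hV.aestronglyMeasurable).1 (h_abs.congr ?_)
  exact Eventually.of_forall fun z ↦ inv_mul_cancel_left₀ (hk_pos z).ne' _
end

section
/- Let d ≥ 1, let V : ℝ^d → ℝ be Borel measurable, and suppose M := sup_{t > 0, x,y ∈ ℝ^d} S(V,t,x,y) < ∞. Then for every x ∈ ℝ^d, ∫₀^∞ ∫_{ℝ^d} g_d(s,x,z) |V(z)| dz ds ≤ M; in particular |V| has bounded Newtonian potential. -/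
open MeasureTheory Real Filter
open scoped ENNReal Topology

/-- As `t → ∞`, the bridge density `g_d(t-s,z,y) / g_d(t,x,y)` relative to `g_d(s,x,·)`
tends to `1`. -/
lemma tendsto_gwk_div_gwk (d : ℕ) (s : ℝ) (x y z : EuclideanSpace ℝ (Fin d)) :
    Tendsto (fun t : ℝ => gwk d (t - s) z y / gwk d t x y) atTop (𝓝 1) := by
  have hsub : Tendsto (fun t : ℝ => t - s) atTop atTop :=
    tendsto_atTop_add_const_right _ (-s) tendsto_id
  have hexp (w : EuclideanSpace ℝ (Fin d)) :
      Tendsto (fun t : ℝ => Real.exp (-‖y - w‖ ^ 2 / (4 * t))) atTop (𝓝 1) := by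
    have h : Tendsto (fun t : ℝ => -‖y - w‖ ^ 2 / (4 * t)) atTop (𝓝 0) :=
      tendsto_const_nhds.div_atTop (tendsto_id.const_mul_atTop (by norm_num))
    simpa using h.rexp
  have hratio : Tendsto (fun t : ℝ => (t - s) / t) atTop (𝓝 1) := by
    have h : Tendsto (fun t : ℝ => 1 - s / t) atTop (𝓝 (1 - 0)) :=
      tendsto_const_nhds.sub (tendsto_const_nhds.div_atTop tendsto_id)
    rw [sub_zero] at h
    refine h.congr' ?_
    filter_upwards [eventually_gt_atTop 0] with t ht
    field_simp
  have hpow : Tendsto (fun t : ℝ => ((t - s) / t) ^ (-(d : ℝ) / 2)) atTop (𝓝 1) := by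
    simpa using hratio.rpow_const (p := -(d : ℝ) / 2) (Or.inl one_ne_zero)
  have key := hpow.mul (((hexp z).comp hsub).div (hexp x) one_ne_zero)
  rw [div_one, mul_one] at key
  refine key.congr' ?_
  filter_upwards [eventually_gt_atTop 0, eventually_gt_atTop s] with t ht hts
  have hts' : 0 < t - s := sub_pos.mpr hts
  have hpi : 0 < 4 * Real.pi := by positivity
  simp only [gwk, Function.comp_apply, Pi.div_apply]
  rw [mul_div_mul_comm, ← Real.div_rpow (by positivity) (by positivity),
    mul_div_mul_left _ _ hpi.ne']

/-- Joint measurability of the heat kernel in time and space. -/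
lemma measurable_gwk (d : ℕ) :
    Measurable fun p : ℝ × EuclideanSpace ℝ (Fin d) × EuclideanSpace ℝ (Fin d) =>
      gwk d p.1 p.2.1 p.2.2 := by
  unfold gwk
  fun_prop

/-- Joint measurability of the integrand of `Sq` in the time and space variables. -/
lemma measurable_Sq_integrand (d : ℕ) {V : EuclideanSpace ℝ (Fin d) → ℝ} (hV : Measurable V)
    (t : ℝ) (x y : EuclideanSpace ℝ (Fin d)) :
    Measurable fun p : ℝ × EuclideanSpace ℝ (Fin d) =>
      ENNReal.ofReal (gwk d p.1 x p.2 * gwk d (t - p.1) p.2 y / gwk d t x y * |V p.2|) := by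
  have h₁ : Measurable fun p : ℝ × EuclideanSpace ℝ (Fin d) => gwk d p.1 x p.2 :=
    (measurable_gwk d).comp
      (measurable_fst.prodMk (measurable_const.prodMk measurable_snd))
  have h₂ : Measurable fun p : ℝ × EuclideanSpace ℝ (Fin d) => gwk d (t - p.1) p.2 y :=
    (measurable_gwk d).comp
      ((measurable_fst.const_sub t).prodMk (measurable_snd.prodMk measurable_const))
  have h₃ : Measurable fun p : ℝ × EuclideanSpace ℝ (Fin d) => |V p.2| :=
    measurable_abs.comp (hV.comp measurable_snd)
  exact (((h₁.mul h₂).div_const _).mul h₃).ennreal_ofReal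

/-- Fatou's lemma for iterated integrals over the time intervals `(0, n)` increasing to
`(0, ∞)`. -/
lemma lintegral_Ioi_lintegral_le_liminf {α : Type*} [MeasurableSpace α] {μ : Measure α}
    [SFinite μ] {f : ℕ → ℝ → α → ℝ≥0∞} {g : ℝ → α → ℝ≥0∞}
    (hf : ∀ n, Measurable (Function.uncurry (f n)))
    (hlim : ∀ s z, Tendsto (fun n => f n s z) atTop (𝓝 (g s z))) :
    ∫⁻ s in Set.Ioi (0 : ℝ), ∫⁻ z, g s z ∂μ ≤
      liminf (fun n : ℕ => ∫⁻ s in Set.Ioo (0 : ℝ) n, ∫⁻ z, f n s z ∂μ) atTop := by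
  have hIoo (n : ℕ) : ∫⁻ s in Set.Ioo (0 : ℝ) n, ∫⁻ z, f n s z ∂μ =
      ∫⁻ s in Set.Ioi (0 : ℝ), (Set.Iio (n : ℝ)).indicator (fun s => ∫⁻ z, f n s z ∂μ) s := by
    rw [setLIntegral_indicator measurableSet_Iio, Set.inter_comm, Set.Ioi_inter_Iio]
  simp_rw [hIoo]
  refine le_trans (lintegral_mono fun s => ?_) (lintegral_liminf_le fun n =>
    (hf n).lintegral_prod_right'.indicator measurableSet_Iio)
  have hev : ∀ᶠ n : ℕ in atTop, ∫⁻ z, f n s z ∂μ =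
      (Set.Iio (n : ℝ)).indicator (fun s => ∫⁻ z, f n s z ∂μ) s := by
    filter_upwards [tendsto_natCast_atTop_atTop.eventually_gt_atTop s] with n hn
    rw [Set.indicator_of_mem (Set.mem_Iio.mpr hn)]
  calc ∫⁻ z, g s z ∂μ
      = ∫⁻ z, liminf (fun n => f n s z) atTop ∂μ :=
        lintegral_congr fun z => (hlim s z).liminf_eq.symm
    _ ≤ liminf (fun n => ∫⁻ z, f n s z ∂μ) atTop :=
        lintegral_liminf_le fun n => (hf n).comp measurable_prodMk_left
    _ = _ := liminf_congr hev

/-- The potential of `|V|` is bounded by the lower limit of `S(V,n,x,y)` as `n → ∞`. -/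
lemma lintegral_gwk_le_liminf_Sq (d : ℕ) {V : EuclideanSpace ℝ (Fin d) → ℝ} (hV : Measurable V)
    (x y : EuclideanSpace ℝ (Fin d)) :
    ∫⁻ s in Set.Ioi (0 : ℝ), ∫⁻ z, ENNReal.ofReal (gwk d s x z * |V z|) ≤
      liminf (fun n : ℕ => Sq d V n x y) atTop := by
  refine lintegral_Ioi_lintegral_le_liminf (fun n => measurable_Sq_integrand d hV n x y)
    fun s z => ?_
  have h := (tendsto_gwk_div_gwk d s x y z).comp tendsto_natCast_atTop_atTop
  have h' := (h.const_mul (gwk d s x z)).mul_const |V z|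
  rw [mul_one] at h'
  refine (ENNReal.tendsto_ofReal h').congr fun n => ?_
  simp only [Function.comp_apply, mul_div_assoc]

/-- if `S(V,t,x,y) ≤ M` for all `t > 0`, `x,y`, then
`∫₀^∞ ∫_{ℝ^d} g_d(s,x,z)|V(z)| dz ds ≤ M` for every `x`. -/
theorem stmt14 (d : ℕ) (hd : 1 ≤ d) (V : EuclideanSpace ℝ (Fin d) → ℝ) (hV : Measurable V)
    (M : ℝ≥0∞) (hM : M < ⊤)
    (hS : ∀ t : ℝ, 0 < t → ∀ x y, Sq d V t x y ≤ M) (x : EuclideanSpace ℝ (Fin d)) :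
    ∫⁻ s in Set.Ioi (0 : ℝ), ∫⁻ z, ENNReal.ofReal (gwk d s x z * |V z|) ≤ M := by
  refine (lintegral_gwk_le_liminf_Sq d hV x x).trans (liminf_le_of_frequently_le' ?_)
  refine Eventually.frequently ?_
  filter_upwards [eventually_gt_atTop 0] with n hn
  exact hS n (Nat.cast_pos.mpr hn) x x
end

section
/- Let d ≥ 1 and let V : ℝ^d → ℝ be Borel measurable. Define f(t) = sup_{x,y ∈ ℝ^d} S(V,t,x,y) ∈ [0,∞] for t > 0. Then f is subadditive: f(t₁ + t₂) ≤ f(t₁) + f(t₂) for all t₁, t₂ > 0. -/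
open MeasureTheory Real Filter
open scoped ENNReal Topology

@[fun_prop]
theorem Measurable.gwk {d : ℕ} {α : Type*} [MeasurableSpace α] {t : α → ℝ}
    {x y : α → EuclideanSpace ℝ (Fin d)} (ht : Measurable t) (hx : Measurable x)
    (hy : Measurable y) : Measurable fun a => gwk d (t a) (x a) (y a) := by
  unfold _root_.gwk
  fun_prop

/-- Completing the square in the product of two Gaussian exponents. -/
theorem norm_sub_sq_div_add_norm_sub_sq_div {E : Type*} [NormedAddCommGroup E]
    [InnerProductSpace ℝ E] {s u : ℝ} (hs : 0 < s) (hu : 0 < u) (x y w : E) :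
    ‖w - x‖ ^ 2 / (4 * s) + ‖y - w‖ ^ 2 / (4 * u) =
      ‖y - x‖ ^ 2 / (4 * (s + u)) +
        (s + u) / (4 * s * u) * ‖w - (x + (s / (s + u)) • (y - x))‖ ^ 2 := by
  have h₁ : y - w = (y - x) - (w - x) := by abel
  have h₂ : w - (x + (s / (s + u)) • (y - x)) = (w - x) - (s / (s + u)) • (y - x) := by abel
  rw [h₁, h₂, norm_sub_sq_real (y - x), norm_sub_sq_real (w - x), real_inner_smul_right, norm_smul, mul_pow,
    real_inner_comm (w - x) (y - x), Real.norm_eq_abs, sq_abs]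
  have : s + u ≠ 0 := by positivity
  field_simp
  ring

theorem gwk_mul_gwk (d : ℕ) {s u : ℝ} (hs : 0 < s) (hu : 0 < u)
    (x y w : EuclideanSpace ℝ (Fin d)) :
    gwk d s x w * gwk d u w y = (4 * π * s) ^ (-(d : ℝ) / 2) * (4 * π * u) ^ (-(d : ℝ) / 2) *
      Real.exp (-‖y - x‖ ^ 2 / (4 * (s + u))) *
        Real.exp (-((s + u) / (4 * s * u)) * ‖w - (x + (s / (s + u)) • (y - x))‖ ^ 2) := by
  have h := norm_sub_sq_div_add_norm_sub_sq_div hs hu x y w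
  unfold gwk
  rw [mul_mul_mul_comm, ← Real.exp_add, mul_assoc _ (Real.exp _), ← Real.exp_add]
  congr 2
  simp only [neg_div, neg_mul]
  linarith

/-- The Chapman–Kolmogorov equations. -/
theorem integral_gwk_mul_gwk (d : ℕ) {s u : ℝ} (hs : 0 < s) (hu : 0 < u)
    (x y : EuclideanSpace ℝ (Fin d)) :
    ∫ w, gwk d s x w * gwk d u w y = gwk d (s + u) x y := by
  have hb : 0 < (s + u) / (4 * s * u) := by positivity
  simp only [gwk_mul_gwk d hs hu]
  rw [integral_const_mul, integral_sub_right_eq_self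
      (fun w : EuclideanSpace ℝ (Fin d) => Real.exp (-((s + u) / (4 * s * u)) * ‖w‖ ^ 2)),
    GaussianFourier.integral_rexp_neg_mul_sq_norm hb, finrank_euclideanSpace_fin]
  have hconst : (4 * π * s) ^ (-(d : ℝ) / 2) * (4 * π * u) ^ (-(d : ℝ) / 2) *
      (π / ((s + u) / (4 * s * u))) ^ ((d : ℝ) / 2) = (4 * π * (s + u)) ^ (-(d : ℝ) / 2) := by
    rw [← inv_inv (π / _), Real.inv_rpow (by positivity), ← Real.rpow_neg (by positivity),
      ← neg_div, ← Real.mul_rpow (by positivity) (by positivity),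
      ← Real.mul_rpow (by positivity) (by positivity)]
    congr 1
    field_simp
  unfold gwk
  rw [← hconst]
  ring

theorem lintegral_gwk_mul_gwk (d : ℕ) {s u : ℝ} (hs : 0 < s) (hu : 0 < u)
    (x y : EuclideanSpace ℝ (Fin d)) :
    ∫⁻ w, ENNReal.ofReal (gwk d s x w) * ENNReal.ofReal (gwk d u w y) =
      ENNReal.ofReal (gwk d (s + u) x y) := by
  have hint := integral_gwk_mul_gwk d hs hu x y
  simp only [← ENNReal.ofReal_mul (gwk_pos d hs _ _).le]
  rw [← hint, ofReal_integral_eq_lintegral_ofReal]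
  · refine Integrable.of_integral_ne_zero ?_
    rw [hint]
    exact (gwk_pos d (by positivity) x y).ne'
  · exact ae_of_all _ fun w => (mul_pos (gwk_pos d hs _ _) (gwk_pos d hu _ _)).le

/-- The numerator of `Sq` is the kernel times `Sq`. -/
theorem lintegral_gwk_mul_gwk_mul_abs (d : ℕ) (V : EuclideanSpace ℝ (Fin d) → ℝ) {t : ℝ}
    (ht : 0 < t) (x y : EuclideanSpace ℝ (Fin d)) :
    ∫⁻ s in Set.Ioo (0 : ℝ) t, ∫⁻ z, ENNReal.ofReal (gwk d s x z) *
      ENNReal.ofReal (gwk d (t - s) z y) * ENNReal.ofReal |V z| =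
      ENNReal.ofReal (gwk d t x y) * Sq d V t x y := by
  have hg := gwk_pos d ht x y
  rw [Sq, ← lintegral_const_mul' _ _ ENNReal.ofReal_ne_top]
  refine setLIntegral_congr_fun measurableSet_Ioo fun s hs => ?_
  rw [← lintegral_const_mul' _ _ ENNReal.ofReal_ne_top]
  refine lintegral_congr fun z => ?_
  have h₁ := gwk_pos d hs.1 x z
  have h₂ := gwk_pos d (sub_pos.2 hs.2) z y
  rw [← ENNReal.ofReal_mul h₁.le, ← ENNReal.ofReal_mul (by positivity),
    ← ENNReal.ofReal_mul hg.le]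
  congr 1
  field_simp

/-- The contribution of the times before `t₁`, conditioning on the position at time `t₁`. -/
theorem lintegral_Ioo_initial (d : ℕ) {V : EuclideanSpace ℝ (Fin d) → ℝ} (hV : Measurable V)
    {t₁ t₂ : ℝ} (h₁ : 0 < t₁) (h₂ : 0 < t₂) (x y : EuclideanSpace ℝ (Fin d)) :
    ∫⁻ s in Set.Ioo (0 : ℝ) t₁, ∫⁻ z, ENNReal.ofReal (gwk d s x z) *
      ENNReal.ofReal (gwk d (t₁ + t₂ - s) z y) * ENNReal.ofReal |V z| =
      ∫⁻ w, ENNReal.ofReal (gwk d t₁ x w) * ENNReal.ofReal (gwk d t₂ w y) * Sq d V t₁ x w := by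
  calc
    _ = ∫⁻ s in Set.Ioo (0 : ℝ) t₁, ∫⁻ w, ∫⁻ z, ENNReal.ofReal (gwk d t₂ w y) *
          (ENNReal.ofReal (gwk d s x z) * ENNReal.ofReal (gwk d (t₁ - s) z w) *
            ENNReal.ofReal |V z|) := by
      refine setLIntegral_congr_fun measurableSet_Ioo fun s hs => ?_
      rw [lintegral_lintegral_swap (by fun_prop)]
      refine lintegral_congr fun z => ?_
      rw [show t₁ + t₂ - s = (t₁ - s) + t₂ by ring,
        ← lintegral_gwk_mul_gwk d (sub_pos.2 hs.2) h₂, mul_right_comm,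
        ← lintegral_const_mul _ (by fun_prop)]
      refine lintegral_congr fun w => ?_
      ring
    _ = ∫⁻ w, ∫⁻ s in Set.Ioo (0 : ℝ) t₁, ∫⁻ z, ENNReal.ofReal (gwk d t₂ w y) *
          (ENNReal.ofReal (gwk d s x z) * ENNReal.ofReal (gwk d (t₁ - s) z w) *
            ENNReal.ofReal |V z|) :=
      lintegral_lintegral_swap
        (Measurable.lintegral_prod_right' (f := fun p : (ℝ × EuclideanSpace ℝ (Fin d)) ×
          EuclideanSpace ℝ (Fin d) => ENNReal.ofReal (gwk d t₂ p.1.2 y) *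
          (ENNReal.ofReal (gwk d p.1.1 x p.2) * ENNReal.ofReal (gwk d (t₁ - p.1.1) p.2 p.1.2) *
            ENNReal.ofReal |V p.2|)) (by fun_prop)).aemeasurable
    _ = _ := by
      refine lintegral_congr fun w => ?_
      simp only [lintegral_const_mul' _ _ ENNReal.ofReal_ne_top]
      rw [lintegral_gwk_mul_gwk_mul_abs d V h₁]
      ring

/-- The contribution of the times after `t₁`, conditioning on the position at time `t₁`. -/
theorem lintegral_Ioo_final (d : ℕ) {V : EuclideanSpace ℝ (Fin d) → ℝ} (hV : Measurable V)
    {t₁ t₂ : ℝ} (h₁ : 0 < t₁) (h₂ : 0 < t₂) (x y : EuclideanSpace ℝ (Fin d)) :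
    ∫⁻ s in Set.Ioo (0 : ℝ) t₂, ∫⁻ z, ENNReal.ofReal (gwk d (t₁ + s) x z) *
      ENNReal.ofReal (gwk d (t₂ - s) z y) * ENNReal.ofReal |V z| =
      ∫⁻ w, ENNReal.ofReal (gwk d t₁ x w) * ENNReal.ofReal (gwk d t₂ w y) * Sq d V t₂ w y := by
  calc
    _ = ∫⁻ s in Set.Ioo (0 : ℝ) t₂, ∫⁻ w, ∫⁻ z, ENNReal.ofReal (gwk d t₁ x w) *
          (ENNReal.ofReal (gwk d s w z) * ENNReal.ofReal (gwk d (t₂ - s) z y) *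
            ENNReal.ofReal |V z|) := by
      refine setLIntegral_congr_fun measurableSet_Ioo fun s hs => ?_
      rw [lintegral_lintegral_swap (by fun_prop)]
      refine lintegral_congr fun z => ?_
      rw [← lintegral_gwk_mul_gwk d h₁ hs.1, mul_assoc, ← lintegral_mul_const _ (by fun_prop)]
      refine lintegral_congr fun w => ?_
      ring
    _ = ∫⁻ w, ∫⁻ s in Set.Ioo (0 : ℝ) t₂, ∫⁻ z, ENNReal.ofReal (gwk d t₁ x w) *
          (ENNReal.ofReal (gwk d s w z) * ENNReal.ofReal (gwk d (t₂ - s) z y) *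
            ENNReal.ofReal |V z|) :=
      lintegral_lintegral_swap
        (Measurable.lintegral_prod_right' (f := fun p : (ℝ × EuclideanSpace ℝ (Fin d)) ×
          EuclideanSpace ℝ (Fin d) => ENNReal.ofReal (gwk d t₁ x p.1.2) *
          (ENNReal.ofReal (gwk d p.1.1 p.1.2 p.2) * ENNReal.ofReal (gwk d (t₂ - p.1.1) p.2 y) *
            ENNReal.ofReal |V p.2|)) (by fun_prop)).aemeasurable
    _ = _ := by
      refine lintegral_congr fun w => ?_
      simp only [lintegral_const_mul' _ _ ENNReal.ofReal_ne_top]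
      rw [lintegral_gwk_mul_gwk_mul_abs d V h₂]
      ring

theorem lintegral_Ioo_add (F : ℝ → ℝ≥0∞) {a b : ℝ} (ha : 0 < a) (hb : 0 < b) :
    ∫⁻ s in Set.Ioo (0 : ℝ) (a + b), F s =
      (∫⁻ s in Set.Ioo (0 : ℝ) a, F s) + ∫⁻ s in Set.Ioo (0 : ℝ) b, F (a + s) := by
  have hshift : ∫⁻ s in Set.Ioo (0 : ℝ) b, F (a + s) = ∫⁻ s in Set.Ioo a (a + b), F s := by
    have h := (measurePreserving_add_left volume a).setLIntegral_comp_preimage_emb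
      (MeasurableEquiv.addLeft a).measurableEmbedding F (Set.Ioo a (a + b))
    simpa using h
  rw [hshift, setLIntegral_congr (Ioo_ae_eq_Ico (a := a) (b := a + b)),
    ← lintegral_union measurableSet_Ico, Set.Ioo_union_Ico_eq_Ioo ha (by linarith)]
  exact Set.disjoint_left.2 fun s hs hs' => hs.2.not_ge hs'.1

/-- A weighted average over the position at time `t₁` is at most the supremum of the weight. -/
theorem lintegral_gwk_mul_gwk_mul_le (d : ℕ) {t₁ t₂ : ℝ} (h₁ : 0 < t₁) (h₂ : 0 < t₂)
    (x y : EuclideanSpace ℝ (Fin d)) {F : EuclideanSpace ℝ (Fin d) → ℝ≥0∞} {C : ℝ≥0∞}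
    (hF : ∀ w, F w ≤ C) :
    ∫⁻ w, ENNReal.ofReal (gwk d t₁ x w) * ENNReal.ofReal (gwk d t₂ w y) * F w ≤
      ENNReal.ofReal (gwk d (t₁ + t₂) x y) * C := by
  rw [← lintegral_gwk_mul_gwk d h₁ h₂, ← lintegral_mul_const _ (by fun_prop)]
  exact lintegral_mono fun w => mul_le_mul_right (hF w) _

/-- `f(t) = sup_{x,y} S(V,t,x,y)` is subadditive. -/
theorem stmt15 (d : ℕ) (hd : 1 ≤ d) (V : EuclideanSpace ℝ (Fin d) → ℝ) (hV : Measurable V)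
    (t₁ t₂ : ℝ) (h₁ : 0 < t₁) (h₂ : 0 < t₂) :
    (⨆ x, ⨆ y, Sq d V (t₁ + t₂) x y) ≤
      (⨆ x, ⨆ y, Sq d V t₁ x y) + ⨆ x, ⨆ y, Sq d V t₂ x y := by
  refine iSup₂_le fun x y => ?_
  have ht : 0 < t₁ + t₂ := add_pos h₁ h₂
  have hg := ENNReal.ofReal_pos.2 (gwk_pos d ht x y)
  rw [← ENNReal.mul_le_mul_iff_right hg.ne' ENNReal.ofReal_ne_top,
    ← lintegral_gwk_mul_gwk_mul_abs d V ht, lintegral_Ioo_add _ h₁ h₂, mul_add,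
    lintegral_Ioo_initial d hV h₁ h₂]
  simp only [add_sub_add_left_eq_sub]
  rw [lintegral_Ioo_final d hV h₁ h₂]
  exact add_le_add
    (lintegral_gwk_mul_gwk_mul_le d h₁ h₂ x y fun w => le_iSup₂ (f := fun x y => Sq d V t₁ x y) x w)
    (lintegral_gwk_mul_gwk_mul_le d h₁ h₂ x y fun w => le_iSup₂ (f := fun x y => Sq d V t₂ x y) w y)
end
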